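/- Let ψ : ℝ²₊ → ℝ₊ be a twice continuously differentiable function that is homogeneous of degree 1, and define h : ℝ³₊ → ℝ₊ by h(x,y,z) = x + ψ(y,z). Then for every twice continuously differentiable function F : ℝ₊ → ℝ, the composition f = F ∘ h satisfies the homogeneous Monge–Ampère equation det(f_ij) = 0 at every point of ℝ³₊. -/

import Mathlib

open Real

/-- Partial derivative of `f` in the `i`-th coordinate direction. -/
noncomputable def pd {n : ℕ} (i : Fin n) (f : (Fin n → ℝ) → ℝ) (x : Fin n → ℝ) : ℝ :=
  fderiv ℝ f x (Pi.single i 1)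

/-- Hessian matrix of second partial derivatives of `f` at `x`. -/
noncomputable def hess {n : ℕ} (f : (Fin n → ℝ) → ℝ) (x : Fin n → ℝ) :
    Matrix (Fin n) (Fin n) ℝ :=
  fun i j => pd i (pd j f) x

/-- Hessian determinant `det(f_ij)` of `f` at `x`. -/
noncomputable def hessDet {n : ℕ} (f : (Fin n → ℝ) → ℝ) (x : Fin n → ℝ) : ℝ :=
  (hess f x).det

/-- The open positive orthant `ℝⁿ₊`. -/
def posOrth (n : ℕ) : Set (Fin n → ℝ) := {x | ∀ i, 0 < x i}

lemma posOrth_open (n : ℕ) : IsOpen (posOrth n) := by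
  have : posOrth n = ⋂ i, {x : Fin n → ℝ | 0 < x i} := by
    ext x; simp [posOrth]
  rw [this]
  exact isOpen_iInter_of_finite fun i => isOpen_lt continuous_const (continuous_apply i)

/-- The continuous linear map `(x,y,z) ↦ (y,z)`. -/
noncomputable def tailL : (Fin 3 → ℝ) →L[ℝ] (Fin 2 → ℝ) :=
  ContinuousLinearMap.pi fun i => ContinuousLinearMap.proj i.succ

lemma fderiv_hom (ψ : (Fin 2 → ℝ) → ℝ)
    (hψC2 : ContDiffOn ℝ 2 ψ (posOrth 2))
    (hψhom : ∀ t : ℝ, 0 < t → ∀ y ∈ posOrth 2, ψ (t • y) = t * ψ y)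
    (t : ℝ) (ht : 0 < t) (y : Fin 2 → ℝ) (hy : y ∈ posOrth 2) :
    fderiv ℝ ψ (t • y) = fderiv ℝ ψ y := by
  have hd : DifferentiableAt ℝ ψ y :=
    (hψC2.contDiffAt ((posOrth_open 2).mem_nhds hy)).differentiableAt (by norm_num)
  have h1 : (fun z => ψ (t • z)) =ᶠ[nhds y] fun z => t • ψ z := by
    filter_upwards [(posOrth_open 2).mem_nhds hy] with z hz
    exact hψhom t ht z hz
  have h2 := h1.fderiv_eq (𝕜 := ℝ)
  rw [fderiv_comp_smul, fderiv_fun_const_smul hd] at h2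
  exact smul_right_injective _ ht.ne' h2

theorem stmt_16
    (ψ : (Fin 2 → ℝ) → ℝ)
    (hψC2 : ContDiffOn ℝ 2 ψ (posOrth 2))
    (hψpos : ∀ y ∈ posOrth 2, 0 < ψ y)
    (hψhom : ∀ t : ℝ, 0 < t → ∀ y ∈ posOrth 2, ψ (t • y) = t * ψ y)
    (F : ℝ → ℝ) (hFC2 : ContDiffOn ℝ 2 F (Set.Ioi (0 : ℝ))) :
    ∀ x ∈ posOrth 3,
      hessDet (fun y : Fin 3 → ℝ => F (y 0 + ψ (fun i => y i.succ))) x = 0 := by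
  intro x hx
  set f : (Fin 3 → ℝ) → ℝ := fun y => F (y 0 + ψ (fun i => y i.succ)) with hf
  have htail : ∀ z ∈ posOrth 3, tailL z ∈ posOrth 2 := fun z hz i => hz i.succ
  have hpos : ∀ z ∈ posOrth 3, 0 < z 0 + ψ (tailL z) := fun z hz =>
    add_pos (hz 0) (hψpos _ (htail z hz))
  have hψat : ∀ y ∈ posOrth 2, ContDiffAt ℝ 2 ψ y := fun y hy =>
    hψC2.contDiffAt ((posOrth_open 2).mem_nhds hy)
  have hFat : ∀ r : ℝ, 0 < r → ContDiffAt ℝ 2 F r := fun r hr =>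
    hFC2.contDiffAt (isOpen_Ioi.mem_nhds hr)
  have hder : ∀ z ∈ posOrth 3, fderiv ℝ f z =
      (fderiv ℝ F (z 0 + ψ (tailL z))).comp
        (ContinuousLinearMap.proj (R := ℝ) (φ := fun _ : Fin 3 => ℝ) 0 +
          (fderiv ℝ ψ (tailL z)).comp tailL) := by
    intro z hz
    have h1 := ((hψat _ (htail z hz)).differentiableAt (by norm_num)).hasFDerivAt
    have h2 := h1.comp z tailL.hasFDerivAt
    have h3 := ((ContinuousLinearMap.proj (R := ℝ) (φ := fun _ : Fin 3 => ℝ) 0).hasFDerivAt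
      (x := z)).add h2
    have h4 := ((hFat _ (hpos z hz)).differentiableAt (by norm_num)).hasFDerivAt
    exact (HasFDerivAt.comp z h4 h3).fderiv
  have hfC : ContDiffAt ℝ 2 f x := by
    have h2 : ContDiffAt ℝ 2 (fun z => ψ (tailL z)) x :=
      (hψat _ (htail x hx)).comp x tailL.contDiff.contDiffAt
    have h3 : ContDiffAt ℝ 2 (fun z : Fin 3 → ℝ => z 0 + ψ (tailL z)) x :=
      (contDiff_apply ℝ ℝ (0 : Fin 3)).contDiffAt.add h2
    exact (hFat _ (hpos x hx)).comp x h3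
  have hpd : ∀ j, DifferentiableAt ℝ (pd j f) x := by
    intro j
    have h1 : DifferentiableAt ℝ (fderiv ℝ f) x :=
      (hfC.fderiv_right (m := 1) (by norm_num)).differentiableAt (by norm_num)
    exact h1.clm_apply (differentiableAt_const _)
  -- the null direction
  let v : Fin 3 → ℝ := Fin.cons (-ψ (tailL x)) (tailL x)
  have hv0 : v 0 = -ψ (tailL x) := rfl
  have hvt : tailL v = tailL x := rfl
  have hline : HasDerivAt (fun s : ℝ => x + s • v) v 0 := by
    simpa using ((hasDerivAt_id (0 : ℝ)).smul_const v).const_add x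
  have hev : ∀ᶠ s : ℝ in nhds 0, x + s • v ∈ posOrth 3 ∧ -1 < s := by
    refine Filter.Eventually.and ?_ (lt_mem_nhds (by norm_num))
    refine hline.continuousAt.eventually_mem ((posOrth_open 3).mem_nhds ?_)
    simpa using hx
  have hkey : ∀ j, fderiv ℝ (pd j f) x v = 0 := by
    intro j
    have hc : (fun s : ℝ => pd j f (x + s • v)) =ᶠ[nhds 0] fun _ => pd j f x := by
      filter_upwards [hev] with s hs
      have ht : tailL (x + s • v) = (1 + s) • tailL x := by
        rw [map_add, map_smul, hvt, add_smul, one_smul]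
      have hs1 : 0 < 1 + s := by linarith [hs.2]
      have hh : (x + s • v) 0 + ψ (tailL (x + s • v)) = x 0 + ψ (tailL x) := by
        rw [ht, hψhom _ hs1 _ (htail x hx)]
        simp only [Pi.add_apply, Pi.smul_apply, hv0, smul_eq_mul]
        ring
      unfold pd
      rw [hder _ hs.1, hder _ hx, hh, ht, fderiv_hom ψ hψC2 hψhom _ hs1 _ (htail x hx)]
    have h0 : HasFDerivAt (pd j f) (fderiv ℝ (pd j f) x) (x + (0 : ℝ) • v) := by
      simpa using (hpd j).hasFDerivAt
    have h1 := h0.comp_hasDerivAt (0 : ℝ) hline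
    have h2 : HasDerivAt (fun s : ℝ => pd j f (x + s • v)) 0 0 :=
      (hasDerivAt_const (0 : ℝ) (pd j f x)).congr_of_eventuallyEq hc
    exact h1.unique h2
  unfold hessDet
  rw [← Matrix.exists_vecMul_eq_zero_iff]
  refine ⟨v, ?_, ?_⟩
  · intro h
    have : v 1 = 0 := by rw [h]; rfl
    exact (hx 1).ne' this
  · ext j
    have h := hkey j
    rw [pi_eq_sum_univ' v, map_sum] at h
    simp only [map_smul, smul_eq_mul] at h
    simp only [Matrix.vecMul, dotProduct, hess, Pi.zero_apply]
    rw [← h]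
    refine Finset.sum_congr rfl fun i _ => ?_
    unfold pd
    congr 2
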